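/- Let 𝒜 = (I, (A_a)_{a∈Σ}, F) be a minimal uniformly convergent WFA. Then for every w ∈ Σ^ω the limit A_w = lim_{k→∞} A_{pref_k(w)} exists, the map w ↦ A_w is continuous from Σ^ω to the n×n real matrices, and f_𝒜(w) = I A_w F for every w ∈ Σ^ω. -/

import Mathlib

open Filter Topology Matrix

/-- The prefix of length `k` of an infinite word `w`. -/
def pref {A : Type*} (w : ℕ → A) (k : ℕ) : List A := (List.range k).map w

/-- The product `A_{v₁} ⋯ A_{v_k}` of matrices along a finite word `v`. -/
def wordProd {A : Type*} {n : ℕ} (M : A → Matrix (Fin n) (Fin n) ℝ) (v : List A) :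
    Matrix (Fin n) (Fin n) ℝ := (v.map M).prod

/-- The word function of the WFA `(I, M, F)`: `v ↦ I A_v F`. -/
def wfaWord {A : Type*} {n : ℕ} (I : Fin n → ℝ) (M : A → Matrix (Fin n) (Fin n) ℝ)
    (F : Fin n → ℝ) (v : List A) : ℝ := I ⬝ᵥ (wordProd M v) *ᵥ F

/-- The WFA with `n` states is left minimal: the row vectors `I A_u` span `ℝⁿ`. -/
def LeftMinimal {A : Type*} {n : ℕ} (I : Fin n → ℝ)
    (M : A → Matrix (Fin n) (Fin n) ℝ) : Prop :=
  Submodule.span ℝ {x : Fin n → ℝ | ∃ u : List A, x = I ᵥ* (wordProd M u)} = ⊤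

/-- The WFA with `n` states is right minimal: the column vectors `A_u F` span `ℝⁿ`. -/
def RightMinimal {A : Type*} {n : ℕ} (M : A → Matrix (Fin n) (Fin n) ℝ)
    (F : Fin n → ℝ) : Prop :=
  Submodule.span ℝ {x : Fin n → ℝ | ∃ u : List A, x = (wordProd M u) *ᵥ F} = ⊤

/-- A word function `F : Σ* → ℝ` is uniformly convergent with ω-function `f`. -/
def UnifConv {A : Type*} (F : List A → ℝ) (f : (ℕ → A) → ℝ) : Prop :=
  (∀ w : ℕ → A, Tendsto (fun k => F (pref w k)) atTop (𝓝 (f w))) ∧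
  ∀ ε > (0 : ℝ), ∃ k₀ : ℕ, ∀ w : ℕ → A, ∀ k > k₀, |F (pref w k) - f w| < ε

/-- The infinite word obtained by putting the finite word `u` in front of `w`. -/
def prepend {A : Type*} : List A → (ℕ → A) → ℕ → A
  | [], w => w
  | a :: u, w => fun i => Nat.casesOn i a (prepend u w)

theorem prepend_append {A : Type*} (u v : List A) (w : ℕ → A) :
    prepend (u ++ v) w = prepend u (prepend v w) := by
  induction u with
  | nil => rfl
  | cons a u ih => simp only [List.cons_append, prepend, ih]

@[simp]
theorem length_pref {A : Type*} (w : ℕ → A) (k : ℕ) : (pref w k).length = k := by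
  simp [pref]

@[simp]
theorem pref_zero {A : Type*} (w : ℕ → A) : pref w 0 = [] := by
  simp [pref]

theorem pref_prepend {A : Type*} (u : List A) (w : ℕ → A) (k : ℕ) :
    pref (prepend u w) (u.length + k) = u ++ pref w k := by
  induction u with
  | nil => simp [prepend]
  | cons a u ih =>
    rw [List.cons_append, ← ih, List.length_cons, Nat.add_right_comm]
    simp [pref, prepend, List.range_succ_eq_map, Function.comp_def]

theorem pref_prepend_length {A : Type*} (u : List A) (w : ℕ → A) :
    pref (prepend u w) u.length = u := by
  simpa using pref_prepend u w 0

theorem wordProd_append {A : Type*} {n : ℕ} (M : A → Matrix (Fin n) (Fin n) ℝ)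
    (u v : List A) : wordProd M (u ++ v) = wordProd M u * wordProd M v := by
  simp [wordProd]

theorem continuous_pref {A B : Type*} [TopologicalSpace A] [DiscreteTopology A]
    [TopologicalSpace B] (g : List A → B) (k : ℕ) : Continuous fun w : ℕ → A => g (pref w k) := by
  have h : (fun w : ℕ → A => g (pref w k)) =
      (fun x : Fin k → A => g (List.ofFn x)) ∘ fun w i => w i := by
    ext w
    simp only [Function.comp_apply, pref, List.ofFn_eq_map]
    rw [← List.map_coe_finRange_eq_range, List.map_map]
    rfl
  rw [h]
  exact continuous_of_discreteTopology.comp (by fun_prop)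

/-- Inserting a fixed word before and a fixed word after the prefixes of `w` preserves uniform
convergence. -/
theorem UnifConv.tendstoUniformly_append {A : Type*} {F : List A → ℝ} {f : (ℕ → A) → ℝ}
    (h : UnifConv F f) (u v : List A) :
    TendstoUniformly (fun k w => F (u ++ pref w k ++ v)) (fun w => f (prepend u w)) atTop := by
  rw [Metric.tendstoUniformly_iff]
  intro ε hε
  obtain ⟨k₀, hk₀⟩ := h.2 (ε / 3) (by positivity)
  filter_upwards [eventually_gt_atTop k₀] with k hk w
  have h₁ := hk₀ (prepend u w) (u.length + k) (by omega)
  have h₂ := hk₀ (prepend (u ++ pref w k) (prepend v w)) (u ++ pref w k).length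
    (by simp only [List.length_append, length_pref]; omega)
  have h₃ := hk₀ (prepend (u ++ pref w k ++ v) w) (u ++ pref w k ++ v).length
    (by simp only [List.length_append, length_pref]; omega)
  rw [pref_prepend] at h₁
  rw [pref_prepend_length] at h₂ h₃
  rw [prepend_append] at h₃
  rw [Real.dist_eq]
  rw [abs_lt] at *
  constructor <;> linarith [h₁.1, h₁.2, h₂.1, h₂.2, h₃.1, h₃.2]

/-- The vectors on which a family of linear forms converges uniformly form a subspace. -/
def uniformConvSubmodule {V X : Type*} [AddCommGroup V] [Module ℝ V] (L : ℕ → X → V →ₗ[ℝ] ℝ) :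
    Submodule ℝ V where
  carrier := {x | ∃ g : X → ℝ, TendstoUniformly (fun k w => L k w x) g atTop}
  zero_mem' := ⟨fun _ => 0, by
    simpa [Metric.tendstoUniformly_iff] using fun ε hε => ⟨0, fun _ _ _ => hε⟩⟩
  add_mem' := by
    rintro x y ⟨g, hg⟩ ⟨g', hg'⟩
    refine ⟨g + g', ?_⟩
    simp only [map_add]
    exact hg.add hg'
  smul_mem' := by
    rintro c x ⟨g, hg⟩
    refine ⟨fun w => c • g w, ?_⟩
    simp only [map_smul]
    exact (uniformContinuous_const_smul c).comp_tendstoUniformly hg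

theorem exists_tendstoUniformly_dotProduct {A : Type*} {n : ℕ} {I : Fin n → ℝ}
    {M : A → Matrix (Fin n) (Fin n) ℝ} {F : Fin n → ℝ} (hl : LeftMinimal I M)
    (hr : RightMinimal M F) {f : (ℕ → A) → ℝ} (hA : UnifConv (wfaWord I M F) f)
    (x y : Fin n → ℝ) :
    ∃ g : (ℕ → A) → ℝ,
      TendstoUniformly (fun k w => x ⬝ᵥ wordProd M (pref w k) *ᵥ y) g atTop := by
  let B (k : ℕ) (w : ℕ → A) : (Fin n → ℝ) →ₗ[ℝ] (Fin n → ℝ) →ₗ[ℝ] ℝ :=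
    Matrix.toLinearMap₂' ℝ (wordProd M (pref w k))
  have hB (k w x y) : B k w x y = x ⬝ᵥ wordProd M (pref w k) *ᵥ y :=
    Matrix.toLinearMap₂'_apply' _ _ _
  have hx (v : List A) : ∃ g : (ℕ → A) → ℝ,
      TendstoUniformly (fun k w => x ⬝ᵥ wordProd M (pref w k) *ᵥ (wordProd M v *ᵥ F)) g atTop := by
    have htop : ⊤ ≤ uniformConvSubmodule fun k w => (B k w).flip (wordProd M v *ᵥ F) := by
      rw [← hl, Submodule.span_le]
      rintro _ ⟨u, rfl⟩
      refine ⟨fun w => f (prepend u w), ?_⟩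
      convert hA.tendstoUniformly_append u v using 3 with k w
      simp only [LinearMap.flip_apply, hB, wfaWord, wordProd_append, ← Matrix.dotProduct_mulVec,
        Matrix.mulVec_mulVec, Matrix.mul_assoc]
    obtain ⟨g, hg⟩ := htop (Submodule.mem_top (x := x))
    exact ⟨g, by simpa only [LinearMap.flip_apply, hB] using hg⟩
  have htop : ⊤ ≤ uniformConvSubmodule fun k w => B k w x := by
    rw [← hr, Submodule.span_le]
    rintro _ ⟨v, rfl⟩
    obtain ⟨g, hg⟩ := hx v
    exact ⟨g, by simpa only [hB] using hg⟩
  obtain ⟨g, hg⟩ := htop (Submodule.mem_top (x := y))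
  exact ⟨g, by simpa only [hB] using hg⟩

/-- Let `𝒜 = (I, (A_a), F)` be a minimal, uniformly convergent WFA.  Then for every
`w ∈ Σ^ω` the limit `A_w = lim_k A_{pref_k(w)}` exists, the map `w ↦ A_w` is continuous,
and `f_𝒜(w) = I A_w F` for every `w`. -/
theorem limit_matrix_exists
    {A : Type*} [Fintype A] [Nonempty A] [TopologicalSpace A] [DiscreteTopology A]
    {n : ℕ} (I : Fin n → ℝ) (M : A → Matrix (Fin n) (Fin n) ℝ) (F : Fin n → ℝ)
    (hl : LeftMinimal I M) (hr : RightMinimal M F)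
    (f : (ℕ → A) → ℝ) (hA : UnifConv (wfaWord I M F) f) :
    ∃ Aω : (ℕ → A) → Matrix (Fin n) (Fin n) ℝ,
      (∀ w : ℕ → A, Tendsto (fun k => wordProd M (pref w k)) atTop (𝓝 (Aω w))) ∧
      Continuous Aω ∧
      ∀ w : ℕ → A, f w = I ⬝ᵥ (Aω w) *ᵥ F := by
  have key (i j : Fin n) : ∃ g : (ℕ → A) → ℝ,
      TendstoUniformly (fun k w => wordProd M (pref w k) i j) g atTop := by
    simpa using exists_tendstoUniformly_dotProduct hl hr hA (Pi.single i 1) (Pi.single j 1)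
  choose g hg using key
  have hlim (w : ℕ → A) : Tendsto (fun k => wordProd M (pref w k)) atTop
      (𝓝 (Matrix.of fun i j => g i j w)) :=
    tendsto_pi_nhds.2 fun i => tendsto_pi_nhds.2 fun j => (hg i j).tendsto_at w
  refine ⟨fun w => Matrix.of fun i j => g i j w, hlim, ?_, fun w => ?_⟩
  · exact continuous_matrix fun i j => (hg i j).continuous
      (Frequently.of_forall fun k => continuous_pref (fun v => wordProd M v i j) k)
  · have hc : Continuous fun N : Matrix (Fin n) (Fin n) ℝ => I ⬝ᵥ N *ᵥ F := by fun_prop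
    exact tendsto_nhds_unique (hA.1 w) ((hc.tendsto _).comp (hlim w))
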